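/- Let p, q : [0,1) → ℝ be integrable, ξ ∈ [0,1), η ∈ ℝ, and n ∈ ℕ. A Walsh polynomial ȳ_n = Σ_{k=0}^{2^n−1} c_k ω_k satisfies ȳ_n(x) = η + S_{2^n}( ∫_ξ^{·} (S_{2^n}q(t) − S_{2^n}p(t) ȳ_n(t)) dt )(x) for all x ∈ [0,1) if and only if its coefficient vector c = (c_0,…,c_{2^n−1})^⊤ satisfies the linear system (I + (Ĵ^ξ)^⊤P) c = η e_0 + (Ĵ^ξ)^⊤ q̂, where q̂ = (q̂_0,…,q̂_{2^n−1})^⊤, e_0 = (1,0,…,0)^⊤, and I is the 2^n × 2^n identity matrix. -/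

import Mathlib

open MeasureTheory Matrix

/-- The `k`-th binary digit of `x ∈ [0,1)`, using the expansion terminating in zeros
for dyadic rationals. -/
noncomputable def binDigit (k : ℕ) (x : ℝ) : ℕ := ⌊x * 2 ^ (k + 1)⌋.toNat % 2

/-- Rademacher functions `r_k(x) = (-1)^{x_k}`. -/
noncomputable def rademacher (k : ℕ) (x : ℝ) : ℝ := (-1 : ℝ) ^ binDigit k x

/-- Walsh–Paley functions `ω_n(x) = ∏_k r_k(x)^{n_k}`. -/
noncomputable def walsh (n : ℕ) (x : ℝ) : ℝ :=
  ∏ k ∈ Finset.range n, if n.testBit k then rademacher k x else 1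

/-- Walsh–Fourier coefficient `f̂_k = ∫₀¹ f ω_k`. -/
noncomputable def fcoef (f : ℝ → ℝ) (k : ℕ) : ℝ := ∫ x in (0:ℝ)..1, f x * walsh k x

/-- The `2^n`-th partial sum of the Walsh–Fourier series:
`S_{2^n} f (x) = ∑_{k<2^n} f̂_k ω_k(x)`. -/
noncomputable def S2 (n : ℕ) (f : ℝ → ℝ) (x : ℝ) : ℝ :=
  ∑ k ∈ Finset.range (2 ^ n), fcoef f k * walsh k x

/-- The Hadamard matrix `W` of size `2^n × 2^n` with entries `W_{ij} = ω_j(i/2^n)`. -/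
noncomputable def Wmat (n : ℕ) : Matrix (Fin (2 ^ n)) (Fin (2 ^ n)) ℝ :=
  fun i j => walsh j.1 ((i.1 : ℝ) / 2 ^ n)

/-- The matrix `Ĵ^ξ` with entries `(Ĵ^ξ)_{k,j} = ∫₀¹ J_k^ξ(x) ω_j(x) dx`, where
`J_k^ξ(x) = ∫_ξ^x ω_k(t) dt`. -/
noncomputable def Jhat (n : ℕ) (ξ : ℝ) : Matrix (Fin (2 ^ n)) (Fin (2 ^ n)) ℝ :=
  fun k j => ∫ x in (0:ℝ)..1, (∫ t in ξ..x, walsh k.1 t) * walsh j.1 x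

/-- The dyadic circulant matrix `P` with entries `P_{ij} = p̂_{i ⊕ j}`. -/
noncomputable def Pmat (n : ℕ) (p : ℝ → ℝ) : Matrix (Fin (2 ^ n)) (Fin (2 ^ n)) ℝ :=
  fun i j => fcoef p (i.1 ^^^ j.1)

theorem walsh_eq_prod_range {n N : ℕ} (h : n < 2 ^ N) (x : ℝ) :
    walsh n x = ∏ k ∈ Finset.range N, if n.testBit k then rademacher k x else 1 := by
  have extend : ∀ {A B : ℕ}, A ≤ B → n < 2 ^ A →
      ∏ k ∈ Finset.range A, (if n.testBit k then rademacher k x else 1) =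
        ∏ k ∈ Finset.range B, if n.testBit k then rademacher k x else 1 := by
    intro A B hAB hA
    refine Finset.prod_subset (Finset.range_mono hAB) fun k _ hk => ?_
    have hAk : A ≤ k := by simpa using hk
    rw [Nat.testBit_eq_false_of_lt (hA.trans_le (Nat.pow_le_pow_right two_pos hAk))]
    simp
  unfold walsh
  rcases le_total n N with hN | hN
  · exact extend hN Nat.lt_two_pow_self
  · exact (extend hN h).symm

theorem rademacher_mul_self (k : ℕ) (x : ℝ) : rademacher k x * rademacher k x = 1 := by
  unfold rademacher
  rw [← mul_pow]
  simp

theorem walsh_zero (x : ℝ) : walsh 0 x = 1 := by simp [walsh]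

theorem walsh_mul_walsh (i j : ℕ) (x : ℝ) : walsh i x * walsh j x = walsh (i ^^^ j) x := by
  have hi : i < 2 ^ (i + j) := Nat.lt_two_pow_self.trans_le
    (Nat.pow_le_pow_right two_pos (Nat.le_add_right i j))
  have hj : j < 2 ^ (i + j) := Nat.lt_two_pow_self.trans_le
    (Nat.pow_le_pow_right two_pos (Nat.le_add_left j i))
  rw [walsh_eq_prod_range hi, walsh_eq_prod_range hj,
    walsh_eq_prod_range (Nat.xor_lt_two_pow hi hj), ← Finset.prod_mul_distrib]
  refine Finset.prod_congr rfl fun k _ => ?_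
  rw [Nat.testBit_xor]
  cases i.testBit k <;> cases j.testBit k <;> simp [rademacher_mul_self]

theorem abs_walsh (n : ℕ) (x : ℝ) : |walsh n x| = 1 := by
  have h : walsh n x * walsh n x = 1 := by rw [walsh_mul_walsh, Nat.xor_self, walsh_zero]
  rcases mul_self_eq_one_iff.mp h with h | h <;> simp [h]

theorem measurable_rademacher (k : ℕ) : Measurable (rademacher k) := by
  have h : Measurable (binDigit k) :=
    (measurable_from_top (f := fun z : ℤ => z.toNat % 2)).comp
      (Int.measurable_floor.comp (measurable_id.mul_const _))
  exact (measurable_from_top (f := fun m : ℕ => (-1 : ℝ) ^ m)).comp h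

theorem measurable_walsh (n : ℕ) : Measurable (walsh n) := by
  unfold walsh
  refine Finset.measurable_fun_prod _ fun k _ => ?_
  split_ifs
  · exact measurable_rademacher k
  · exact measurable_const

theorem intervalIntegrable_walsh (n : ℕ) (a b : ℝ) : IntervalIntegrable (walsh n) volume a b :=
  (intervalIntegrable_const (c := (1 : ℝ))).mono_fun (measurable_walsh n).aestronglyMeasurable
    (.of_forall fun x => by simp [abs_walsh])

theorem rademacher_succ (k : ℕ) (x : ℝ) : rademacher (k + 1) x = rademacher k (2 * x) := by
  have h : x * 2 ^ (k + 1 + 1) = 2 * x * 2 ^ (k + 1) := by ring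
  rw [rademacher, rademacher, binDigit, binDigit, h]

theorem rademacher_add_one (k : ℕ) {x : ℝ} (hx : 0 ≤ x) :
    rademacher k (x + 1) = rademacher k x := by
  have hfloor : ⌊(x + 1) * 2 ^ (k + 1)⌋ = ⌊x * 2 ^ (k + 1)⌋ + 2 ^ (k + 1) := by
    rw [← Int.floor_add_intCast]
    congr 1
    push_cast
    ring
  have h0 : 0 ≤ ⌊x * 2 ^ (k + 1)⌋ := Int.floor_nonneg.mpr (by positivity)
  unfold rademacher binDigit
  congr 1
  rw [hfloor, pow_succ (2 : ℤ)]
  have hpow : (0 : ℤ) ≤ 2 ^ k := by positivity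
  omega

theorem walsh_add_one (n : ℕ) {x : ℝ} (hx : 0 ≤ x) : walsh n (x + 1) = walsh n x := by
  simp only [walsh, rademacher_add_one _ hx]

theorem walsh_bit (b : Bool) (m : ℕ) (x : ℝ) :
    walsh (Nat.bit b m) x = (if b then rademacher 0 x else 1) * walsh m (2 * x) := by
  have h : Nat.bit b m < 2 ^ (m + 1) := by
    have := Nat.lt_two_pow_self (n := m)
    rw [Nat.bit_val, pow_succ]
    cases b <;> simp <;> omega
  rw [walsh_eq_prod_range h, Finset.prod_range_succ', mul_comm, walsh]
  simp only [Nat.testBit_bit_succ, Nat.testBit_bit_zero, rademacher_succ]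

theorem rademacher_zero_half {x : ℝ} (hx : x ∈ Set.Ioo (0 : ℝ) 1) :
    rademacher 0 (2⁻¹ * x) = 1 := by
  have h : ⌊2⁻¹ * x * 2 ^ (0 + 1)⌋ = 0 := by
    rw [Int.floor_eq_zero_iff]
    constructor <;> linarith [hx.1, hx.2]
  rw [rademacher, binDigit, h]
  simp

theorem rademacher_zero_half_add_one {x : ℝ} (hx : x ∈ Set.Ioo (0 : ℝ) 1) :
    rademacher 0 (2⁻¹ * (x + 1)) = -1 := by
  have h : ⌊2⁻¹ * (x + 1) * 2 ^ (0 + 1)⌋ = 1 := by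
    rw [Int.floor_eq_iff]
    constructor <;> push_cast <;> linarith [hx.1, hx.2]
  rw [rademacher, binDigit, h]
  simp

theorem integral_walsh_bit (b : Bool) (m : ℕ) :
    ∫ x in (0 : ℝ)..1, walsh (Nat.bit b m) x = if b then 0 else ∫ x in (0 : ℝ)..1, walsh m x := by
  have hcomp : ∀ x, walsh (Nat.bit b m) (2⁻¹ * x) =
      (if b then rademacher 0 (2⁻¹ * x) else 1) * walsh m x := fun x => by
    rw [walsh_bit, mul_inv_cancel_left₀ two_ne_zero]
  have hint : ∀ u v, IntervalIntegrable (fun x => walsh (Nat.bit b m) (2⁻¹ * x)) volume u v :=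
    fun u v => (intervalIntegrable_const (c := (1 : ℝ))).mono_fun
      ((measurable_walsh _).comp (measurable_id.const_mul _)).aestronglyMeasurable
      (.of_forall fun x => by simp [abs_walsh])
  have hscale : ∫ x in (0 : ℝ)..1, walsh (Nat.bit b m) x =
      2⁻¹ * ∫ x in (0 : ℝ)..2, walsh (Nat.bit b m) (2⁻¹ * x) := by
    rw [intervalIntegral.integral_comp_mul_left _ (by norm_num : (2⁻¹ : ℝ) ≠ 0)]
    simp
  have hshift : ∫ x in (1 : ℝ)..2, walsh (Nat.bit b m) (2⁻¹ * x) =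
      ∫ x in (0 : ℝ)..1, walsh (Nat.bit b m) (2⁻¹ * (x + 1)) := by
    rw [intervalIntegral.integral_comp_add_right (fun x => walsh (Nat.bit b m) (2⁻¹ * x))]
    norm_num
  have hleft : ∫ x in (0 : ℝ)..1, walsh (Nat.bit b m) (2⁻¹ * x) = ∫ x in (0 : ℝ)..1, walsh m x :=
    intervalIntegral.integral_congr_Ioo_of_le zero_le_one fun x hx => by
      simp [hcomp, rademacher_zero_half hx]
  have hright : ∫ x in (0 : ℝ)..1, walsh (Nat.bit b m) (2⁻¹ * (x + 1)) =
      ∫ x in (0 : ℝ)..1, (if b then -1 else 1) * walsh m x :=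
    intervalIntegral.integral_congr_Ioo_of_le zero_le_one fun x hx => by
      simp only [hcomp, rademacher_zero_half_add_one hx, walsh_add_one m hx.1.le]
  rw [hscale, ← intervalIntegral.integral_add_adjacent_intervals (hint 0 1) (hint 1 2),
    hshift, hleft, hright, intervalIntegral.integral_const_mul]
  cases b <;> simp
  ring

theorem integral_walsh (n : ℕ) : ∫ x in (0 : ℝ)..1, walsh n x = if n = 0 then 1 else 0 := by
  induction n using Nat.binaryRec with
  | zero => simp [walsh_zero]
  | bit b m ih =>
    rw [integral_walsh_bit, ih]
    cases b <;> simp [Nat.bit_val]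

theorem fcoef_walsh (i j : ℕ) : fcoef (walsh i) j = if i = j then 1 else 0 := by
  simp only [fcoef, walsh_mul_walsh, integral_walsh, Nat.xor_eq_zero_iff]

theorem intervalIntegrable_mul_walsh {f : ℝ → ℝ} {a b : ℝ} (hf : IntervalIntegrable f volume a b)
    (j : ℕ) : IntervalIntegrable (fun x => f x * walsh j x) volume a b :=
  hf.mono_fun (hf.def'.aestronglyMeasurable.mul (measurable_walsh j).aestronglyMeasurable)
    (.of_forall fun x => by simp [abs_walsh])

theorem fcoef_sum {ι : Type*} [Fintype ι] (a : ι → ℝ) (f : ι → ℝ → ℝ)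
    (hf : ∀ i, IntervalIntegrable (f i) volume 0 1) (j : ℕ) :
    fcoef (fun x => ∑ i, a i * f i x) j = ∑ i, a i * fcoef (f i) j := by
  simp only [fcoef, Finset.sum_mul, mul_assoc]
  rw [intervalIntegral.integral_finsetSum
    fun i _ => (intervalIntegrable_mul_walsh (hf i) j).const_mul (a i)]
  simp only [intervalIntegral.integral_const_mul]

theorem fcoef_walsh_sum {N : ℕ} (a : Fin N → ℝ) (j : Fin N) :
    fcoef (fun x => ∑ k, a k * walsh k.1 x) j.1 = a j := by
  rw [fcoef_sum a (fun k => walsh k.1) fun k => intervalIntegrable_walsh k.1 0 1]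
  simp [fcoef_walsh, Fin.val_inj]

/-- The Walsh functions are linearly independent on `[0,1)`. -/
theorem walsh_sum_eq_iff {N : ℕ} (a b : Fin N → ℝ) :
    (∀ x ∈ Set.Ico (0 : ℝ) 1, ∑ k, a k * walsh k.1 x = ∑ k, b k * walsh k.1 x) ↔ a = b := by
  refine ⟨fun h => ?_, fun h => by simp [h]⟩
  ext j
  rw [← fcoef_walsh_sum a j, ← fcoef_walsh_sum b j]
  exact intervalIntegral.integral_congr_Ioo_of_le zero_le_one fun x hx => by
    simp only [h x ⟨hx.1.le, hx.2⟩]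

theorem walsh_sum_mul_walsh_sum (n : ℕ) (f : ℕ → ℝ) (c : Fin (2 ^ n) → ℝ) (x : ℝ) :
    (∑ i : Fin (2 ^ n), f i.1 * walsh i.1 x) * ∑ j, c j * walsh j.1 x =
      ∑ i : Fin (2 ^ n), (∑ j : Fin (2 ^ n), f (i.1 ^^^ j.1) * c j) * walsh i.1 x := by
  have hxor (j : Fin (2 ^ n)) : ∑ i : Fin (2 ^ n), f i.1 * walsh i.1 x * (c j * walsh j.1 x) =
      ∑ i : Fin (2 ^ n), f (i.1 ^^^ j.1) * c j * walsh i.1 x := by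
    let e : Equiv.Perm (Fin (2 ^ n)) := Function.Involutive.toPerm
      (fun i => ⟨i.1 ^^^ j.1, Nat.xor_lt_two_pow i.2 j.2⟩)
      fun i => Fin.ext (Nat.xor_xor_cancel_right i.1 j.1)
    rw [← Equiv.sum_comp e]
    refine Finset.sum_congr rfl fun i _ => ?_
    have h : walsh (i.1 ^^^ j.1) x * walsh j.1 x = walsh i.1 x := by
      rw [walsh_mul_walsh, Nat.xor_xor_cancel_right]
    change f (i.1 ^^^ j.1) * walsh (i.1 ^^^ j.1) x * (c j * walsh j.1 x) = _
    rw [← h]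
    ring
  rw [Finset.sum_mul_sum, Finset.sum_comm]
  simp only [hxor, Finset.sum_mul]
  exact Finset.sum_comm

theorem S2_eq_sum_fin (n : ℕ) (f : ℝ → ℝ) (x : ℝ) :
    S2 n f x = ∑ k : Fin (2 ^ n), fcoef f k.1 * walsh k.1 x := by
  rw [S2, Finset.sum_range]

theorem fcoef_integral_walsh_sum (n : ℕ) (ξ : ℝ) (d : Fin (2 ^ n) → ℝ) (j : Fin (2 ^ n)) :
    fcoef (fun s => ∫ t in ξ..s, ∑ k, d k * walsh k.1 t) j.1 = ((Jhat n ξ)ᵀ.mulVec d) j := by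
  have hprim : ∀ s, ∫ t in ξ..s, ∑ k, d k * walsh k.1 t =
      ∑ k, d k * ∫ t in ξ..s, walsh k.1 t := fun s => by
    rw [intervalIntegral.integral_finsetSum
      fun k _ => (intervalIntegrable_walsh k.1 ξ s).const_mul (d k)]
    simp only [intervalIntegral.integral_const_mul]
  simp only [hprim]
  rw [fcoef_sum d (fun k s => ∫ t in ξ..s, walsh k.1 t) fun k =>
    (intervalIntegral.continuous_primitive (intervalIntegrable_walsh k.1) ξ).intervalIntegrable 0 1]
  simp only [mulVec, dotProduct, transpose_apply, Jhat, fcoef, mul_comm]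

/-- A Walsh polynomial `ȳ_n = ∑ c_k ω_k` satisfies the discretized integral equation
iff its coefficient vector satisfies the linear system
`(I + (Ĵ^ξ)ᵀ P) c = η e₀ + (Ĵ^ξ)ᵀ q̂`. -/
theorem discretized_equation_iff_linear_system (p q : ℝ → ℝ)
    (hpi : IntegrableOn p (Set.Ico (0:ℝ) 1)) (hqi : IntegrableOn q (Set.Ico (0:ℝ) 1))
    (ξ : ℝ) (hξ : ξ ∈ Set.Ico (0:ℝ) 1) (η : ℝ) (n : ℕ) (c : Fin (2 ^ n) → ℝ) :
    (∀ x ∈ Set.Ico (0:ℝ) 1,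
        (∑ k : Fin (2 ^ n), c k * walsh k.1 x) =
          η + S2 n (fun s => ∫ t in ξ..s,
            (S2 n q t - S2 n p t * ∑ k : Fin (2 ^ n), c k * walsh k.1 t)) x) ↔
      (1 + (Jhat n ξ)ᵀ * Pmat n p).mulVec c =
        (fun i => if i.1 = 0 then η else 0) +
          (Jhat n ξ)ᵀ.mulVec (fun k => fcoef q k.1) := by
  set d : Fin (2 ^ n) → ℝ := (fun k => fcoef q k.1) - (Pmat n p).mulVec c with hd
  have hintegrand : ∀ t, S2 n q t - S2 n p t * ∑ k : Fin (2 ^ n), c k * walsh k.1 t =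
      ∑ k, d k * walsh k.1 t := fun t => by
    rw [S2_eq_sum_fin, S2_eq_sum_fin, walsh_sum_mul_walsh_sum, ← Finset.sum_sub_distrib]
    simp only [hd, Pi.sub_apply, mulVec, dotProduct, Pmat, sub_mul]
  have hrhs : ∀ x, η + S2 n (fun s => ∫ t in ξ..s, ∑ k, d k * walsh k.1 t) x =
      ∑ k : Fin (2 ^ n), ((fun i : Fin (2 ^ n) => if i.1 = 0 then η else 0) +
        (Jhat n ξ)ᵀ.mulVec d) k * walsh k.1 x := fun x => by
    have hconst : ∑ k : Fin (2 ^ n), (if k.1 = 0 then η else 0) * walsh k.1 x = η := by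
      rw [Finset.sum_eq_single ⟨0, by positivity⟩]
      · simp [walsh_zero]
      · intro k _ hk
        rw [if_neg fun h => hk (Fin.ext h), zero_mul]
      · simp
    simp only [S2_eq_sum_fin, fcoef_integral_walsh_sum, Pi.add_apply, add_mul,
      Finset.sum_add_distrib, hconst]
  simp only [hintegrand, hrhs]
  rw [walsh_sum_eq_iff, add_mulVec, one_mulVec, ← mulVec_mulVec, hd, mulVec_sub, ← add_sub_assoc,
    eq_sub_iff_add_eq]
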